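/- Let N, k, ℓ, n be integers with 0 ≤ n ≤ ℓ ≤ N and 0 ≤ k − n ≤ N − ℓ, and set M = N − k − ℓ + n. Then in the field ℚ(q,t): Σ_{m'=0}^{M} q^{-m'} · t^{-m'(M−m')} · [M choose m']_t / (t^{k−N+1}q^{-1};t)_{m'+ℓ−n} = 1/(q^{-1};t^{-1})_{N−k}. -/

import Mathlib

/-!
Statement 2: with M = N − k − ℓ + n,
  ∑_{m'=0}^{M} q^{-m'} t^{-m'(M−m')} [M choose m']_t / (t^{k−N+1}q^{-1};t)_{m'+ℓ−n}
    = 1/(q^{-1};t^{-1})_{N−k}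
in the field ℚ(q,t).
-/

open Finset MvPolynomial

noncomputable section

/-- The field ℚ(q,t): fraction field of ℚ[q,t] (variables indexed by `Bool`). -/
abbrev Fqt : Type := FractionRing (MvPolynomial Bool ℚ)

/-- The indeterminate q. -/
def qF : Fqt := algebraMap (MvPolynomial Bool ℚ) Fqt (X true)

/-- The indeterminate t. -/
def tF : Fqt := algebraMap (MvPolynomial Bool ℚ) Fqt (X false)

/-- The q-Pochhammer symbol (a;b)_n = ∏_{i=0}^{n-1} (1 - a·bⁱ). -/
def poch (a b : Fqt) (n : ℕ) : Fqt := ∏ i ∈ Finset.range n, (1 - a * b ^ i)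

/-- The t-binomial coefficient [n choose k]_t = (t;t)_n / ((t;t)_k (t;t)_{n−k}). -/
def tbinom (n k : ℕ) : Fqt := poch tF tF n / (poch tF tF k * poch tF tF (n - k))

lemma qF_mul_tF_pow_ne_one (j : ℕ) : qF * tF ^ j ≠ 1 := by
  intro h
  rw [qF, tF, ← map_pow, ← map_mul, ← map_one (algebraMap (MvPolynomial Bool ℚ) Fqt)] at h
  have h0 := congrArg (eval fun _ => (0 : ℚ)) (IsFractionRing.injective _ _ h)
  simp at h0

lemma tF_pow_succ_ne_one (j : ℕ) : tF ^ (j + 1) ≠ 1 := by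
  intro h
  rw [tF, ← map_pow, ← map_one (algebraMap (MvPolynomial Bool ℚ) Fqt)] at h
  have h0 := congrArg (eval fun _ => (0 : ℚ)) (IsFractionRing.injective _ _ h)
  simp at h0

lemma qF_ne_zero : qF ≠ 0 :=
  (map_ne_zero_iff _ (IsFractionRing.injective _ _)).2 (X_ne_zero _)

lemma tF_ne_zero : tF ≠ 0 :=
  (map_ne_zero_iff _ (IsFractionRing.injective _ _)).2 (X_ne_zero _)

lemma poch_zero (a b : Fqt) : poch a b 0 = 1 := by
  simp [poch]

lemma poch_succ (a b : Fqt) (n : ℕ) : poch a b (n + 1) = poch a b n * (1 - a * b ^ n) :=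
  prod_range_succ _ _

lemma poch_tF_ne_zero (n : ℕ) : poch tF tF n ≠ 0 := by
  refine prod_ne_zero_iff.2 fun i _ => sub_ne_zero.2 ?_
  rw [← pow_succ']
  exact (tF_pow_succ_ne_one i).symm

lemma poch_qF_inv_ne_zero (n : ℕ) : poch qF⁻¹ tF⁻¹ n ≠ 0 := by
  refine prod_ne_zero_iff.2 fun i _ => sub_ne_zero.2 fun h => qF_mul_tF_pow_ne_one i ?_
  rw [inv_pow, ← mul_inv] at h
  exact inv_eq_one.1 h.symm

/-- Splitting a Pochhammer symbol of base `b⁻¹`, with the last `s` factors taken in reverse. -/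
lemma poch_inv_add (a : Fqt) {b : Fqt} (hb : b ≠ 0) (j s : ℕ) :
    poch a b⁻¹ (j + s) = poch a b⁻¹ j * poch (b ^ (1 - (j : ℤ) - s) * a) b s := by
  rw [poch, prod_range_add, ← prod_range_reflect (fun i => 1 - a * b⁻¹ ^ (j + i))]
  refine congrArg _ (prod_congr rfl fun i hi => ?_)
  have hi' := mem_range.1 hi
  have h : b⁻¹ ^ (j + (s - 1 - i)) = b ^ (1 - (j : ℤ) - s) * b ^ i := by
    rw [inv_pow, ← zpow_natCast, ← zpow_neg, ← zpow_natCast b i, ← zpow_add₀ hb]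
    congr 1
    omega
  rw [h]
  ring

/-- The `t⁻¹`-binomial coefficient `[i + j choose i]`, written in terms of `t`. -/
def invBinom (i j : ℕ) : Fqt :=
  tF⁻¹ ^ (i * j) * (poch tF tF (i + j) / (poch tF tF i * poch tF tF j))

lemma invBinom_zero_left (j : ℕ) : invBinom 0 j = 1 := by
  simp [invBinom, poch_zero, poch_tF_ne_zero]

lemma invBinom_zero_right (i : ℕ) : invBinom i 0 = 1 := by
  simp [invBinom, poch_zero, poch_tF_ne_zero]

lemma invBinom_succ_succ (i j : ℕ) :
    invBinom (i + 1) (j + 1) =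
      invBinom (i + 1) j + tF⁻¹ ^ (j + 1) * invBinom i (j + 1) := by
  have ht := tF_ne_zero
  have hi := poch_tF_ne_zero i
  have hj := poch_tF_ne_zero j
  have hi' : 1 - tF * tF ^ i ≠ 0 :=
    right_ne_zero_of_mul (poch_succ _ _ i ▸ poch_tF_ne_zero (i + 1))
  have hj' : 1 - tF * tF ^ j ≠ 0 :=
    right_ne_zero_of_mul (poch_succ _ _ j ▸ poch_tF_ne_zero (j + 1))
  rw [invBinom, invBinom, invBinom, show i + 1 + (j + 1) = i + j + 1 + 1 by ring,
    show i + 1 + j = i + j + 1 by ring, show i + (j + 1) = i + j + 1 by ring,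
    poch_succ _ _ (i + j + 1), poch_succ _ _ i, poch_succ _ _ j]
  simp only [inv_pow]
  field_simp
  ring

/-- The terminating `q`-binomial identity `∑ [M choose i]_p a^i (a;p)_{M-i} = 1` at `p = t⁻¹`. -/
lemma sum_invBinom_mul_poch (a : Fqt) (M : ℕ) :
    ∑ x ∈ antidiagonal M, invBinom x.1 x.2 * a ^ x.1 * poch a tF⁻¹ x.2 = 1 := by
  induction M with
  | zero => simp [invBinom_zero_left, poch_zero]
  | succ M ih =>
    have split : ∑ x ∈ antidiagonal M, invBinom x.1 x.2 * a ^ x.1 * poch a tF⁻¹ x.2 =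
        ∑ x ∈ antidiagonal M, invBinom x.1 x.2 * a ^ x.1 * poch a tF⁻¹ (x.2 + 1) +
        ∑ x ∈ antidiagonal M, tF⁻¹ ^ x.2 * invBinom x.1 x.2 * a ^ (x.1 + 1) * poch a tF⁻¹ x.2 := by
      rw [← sum_add_distrib]
      refine sum_congr rfl fun x _ => ?_
      rw [poch_succ]
      ring
    rw [← ih, split]
    cases M with
    | zero => simp [Nat.antidiagonal_succ, invBinom_zero_left, invBinom_zero_right]
    | succ M =>
      rw [Nat.sum_antidiagonal_succ, Nat.sum_antidiagonal_succ',
        Nat.sum_antidiagonal_succ, Nat.sum_antidiagonal_succ']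
      simp only [invBinom_succ_succ, invBinom_zero_left, invBinom_zero_right, add_mul,
        sum_add_distrib]
      ring

theorem stmt2 (N k ℓ n : ℕ) (h1 : n ≤ ℓ) (h2 : ℓ ≤ N) (h3 : n ≤ k) (h4 : k - n ≤ N - ℓ) :
    ∑ m' ∈ Finset.range (N + n - k - ℓ + 1),
      qF⁻¹ ^ m' * tF⁻¹ ^ (m' * (N + n - k - ℓ - m')) * tbinom (N + n - k - ℓ) m' /
        poch (tF ^ ((k : ℤ) - N + 1) * qF⁻¹) tF (m' + (ℓ - n))
    = (poch qF⁻¹ tF⁻¹ (N - k))⁻¹ := by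
  obtain ⟨r, rfl⟩ := Nat.exists_eq_add_of_le h1
  obtain ⟨c, rfl⟩ := Nat.exists_eq_add_of_le h3
  obtain ⟨M, rfl⟩ : ∃ M, N = n + r + c + M := ⟨N - (n + r) - c, by omega⟩
  rw [show n + r + c + M + n - (n + c) - (n + r) = M by omega,
    show n + r + c + M - (n + c) = M + r by omega]
  refine eq_inv_of_mul_eq_one_left ?_
  rw [sum_mul, ← sum_invBinom_mul_poch qF⁻¹ M,
    Nat.sum_antidiagonal_eq_sum_range_succ_mk]
  refine sum_congr rfl fun m hm => ?_
  obtain ⟨j, rfl⟩ := Nat.exists_eq_add_of_le (Nat.lt_succ_iff.1 (mem_range.1 hm))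
  have hsplit := poch_inv_add qF⁻¹ tF_ne_zero j (m + r)
  have hne := poch_qF_inv_ne_zero (j + (m + r))
  rw [hsplit] at hne
  rw [show m + j + r = j + (m + r) by ring, hsplit, Nat.add_sub_cancel_left,
    Nat.add_sub_cancel_left,
    show ((n + c : ℕ) : ℤ) - (n + r + c + (m + j) : ℕ) + 1 = 1 - (j : ℤ) - (m + r : ℕ) by
      push_cast; ring, tbinom, Nat.add_sub_cancel_left, invBinom]
  have hD := right_ne_zero_of_mul hne
  rw [div_mul_eq_mul_div, div_eq_iff hD]
  ring

end
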